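/- Let n ≥ 4. The number of collections T = {T_1, T_2, T_3} of three distinct 3-element subsets of {1,…,n} satisfying D_3({T_i, T_j}) > 0 for all pairs i < j and D_3({T_1, T_2, T_3}) > 0 (that is, λ_{n,3}((1,1,1)), the number of elements of L(n,3) of type (1,1,1)) equals 280·C(n,9) + 840·C(n,8) + 630·C(n,7) + 120·C(n,6), where C(a,b) denotes the binomial coefficient (equal to 0 when b > a). -/

import Mathlib

attribute [local instance] Classical.propDecidable

/-- Collections of subsets of `{1,…,n}` (modelled as `Fin n`). -/
abbrev Coll (n : ℕ) := Finset (Finset (Fin n))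

/-- `codim_d X = d + 1 - |X|`. -/
def codim {n : ℕ} (d : ℕ) (X : Finset (Fin n)) : ℤ := (d : ℤ) + 1 - X.card

/-- `ρ_d T = Σ_{X ∈ T} codim_d X`. -/
def rho {n : ℕ} (d : ℕ) (T : Coll n) : ℤ := ∑ X ∈ T, codim d X

/-- `D_d T = codim_d (T_1 ∩ … ∩ T_l) - ρ_d T` (used when `|T| ≥ 2`). -/
def Dd {n : ℕ} (d : ℕ) (T : Coll n) : ℤ := codim d (T.inf id) - rho d T

/-- Membership in the lattice `L(n,d)`. -/
def memL (n d : ℕ) (T : Coll n) : Prop :=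
  (∀ T' ⊆ T, 2 ≤ T'.card → 0 < Dd d T') ∧ ∀ X ∈ T, X.card ≤ d

/-- The intersection lattice `L(n,d)`. -/
structure L (n d : ℕ) where
  val : Coll n
  mem : memL n d val

namespace L

instance (n d : ℕ) : PartialOrder (L n d) where
  le S T := S = T ∨ (rho d S.val < rho d T.val ∧ ∀ X ∈ S.val, ∃ Y ∈ T.val, Y ⊆ X)
  le_refl S := Or.inl rfl
  le_trans S T U hST hTU := by
    rcases hST with rfl | hST
    · exact hTU
    · rcases hTU with rfl | hTU
      · exact Or.inr hST
      · refine Or.inr ⟨hST.1.trans hTU.1, fun X hX => ?_⟩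
        obtain ⟨Y, hY, hYX⟩ := hST.2 X hX
        obtain ⟨Z, hZ, hZY⟩ := hTU.2 Y hY
        exact ⟨Z, hZ, hZY.trans hYX⟩
  le_antisymm S T hST hTS := by
    rcases hST with rfl | hST
    · rfl
    · rcases hTS with rfl | hTS
      · rfl
      · exact absurd (hST.1.trans hTS.1) (lt_irrefl _)

noncomputable instance (n d : ℕ) : Fintype (L n d) :=
  Fintype.ofInjective (fun T : L n d => T.val)
    (fun a b h => by cases a; cases b; simpa using h)

end L

/-- The minimum element `∅` of `L(n,d)`. -/
def Lbot (n d : ℕ) : L n d :=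
  ⟨∅, by
    constructor
    · intro T' hT' h2
      rw [Finset.subset_empty] at hT'
      subst hT'
      simp at h2
    · intro X hX
      simp at hX⟩

/-- The maximum element `{∅}` of `L(n,d)`. -/
def Ltop (n d : ℕ) : L n d :=
  ⟨{∅}, by
    constructor
    · intro T' hT' h2
      have h1 : T'.card ≤ 1 := (Finset.card_le_card hT').trans_eq (Finset.card_singleton _)
      exact absurd h2 (by omega)
    · intro X hX
      rw [Finset.mem_singleton] at hX
      subst hX
      simp⟩

/-- The singleton collection `{X}` as an element of `L(n,d)`. -/
def singL (n d : ℕ) (X : Finset (Fin n)) (hX : X.card ≤ d) : L n d :=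
  ⟨{X}, by
    constructor
    · intro T' hT' h2
      have h1 : T'.card ≤ 1 := (Finset.card_le_card hT').trans_eq (Finset.card_singleton _)
      exact absurd h2 (by omega)
    · intro Y hY
      rw [Finset.mem_singleton] at hY
      subst hY
      exact hX⟩

/-- The type of `T ∈ L(n,d)`: the multiset of codimensions of its members. -/
def typeOf {n : ℕ} (d : ℕ) (T : L n d) : Multiset ℕ :=
  T.val.val.map (fun X => d + 1 - X.card)

/-- `λ_{n,d}(γ)`: the number of elements of `L(n,d)` of type `γ`. -/
noncomputable def lam (n d : ℕ) (γ : Multiset ℕ) : ℕ :=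
  (Finset.univ.filter (fun T : L n d => typeOf d T = γ)).card

/-- `κ_{n,d}(m,T)`: the number of `m`-element sets of `d`-element subsets of `{1,…,n}`
whose corresponding hyperplanes have least upper bound `T` in `L(n,d)`. -/
noncomputable def kappa (n d m : ℕ) (T : L n d) : ℕ :=
  (Finset.univ.filter (fun H : Coll n =>
      H.card = m ∧ (∀ X ∈ H, X.card = d) ∧
      IsLUB {S : L n d | ∃ X ∈ H, S.val = {X}} T)).card

open Finset in
/-- The number of ways to pick `a`, `b`, `c` elements from three disjoint blocks. -/
theorem card_filter_card_inter {α : Type*} [DecidableEq α] {X Y Z : Finset α}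
    (hXY : Disjoint X Y) (hXZ : Disjoint X Z) (hYZ : Disjoint Y Z) (a b c : ℕ) :
    #{C ∈ (X ∪ Y ∪ Z).powerset | #(C ∩ X) = a ∧ #(C ∩ Y) = b ∧ #(C ∩ Z) = c} =
      (#X).choose a * (#Y).choose b * (#Z).choose c := by
  rw [← card_powersetCard, ← card_powersetCard, ← card_powersetCard, ← card_product,
    ← card_product]
  rw [Finset.disjoint_left] at hXY hXZ hYZ
  refine card_nbij' (fun C => ((C ∩ X, C ∩ Y), C ∩ Z)) (fun p => p.1.1 ∪ p.1.2 ∪ p.2)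
    ?_ ?_ ?_ ?_
  · intro C hC
    simp only [coe_filter, mem_powerset, Set.mem_ofPred_eq] at hC
    simp [hC.2]
  · rintro ⟨⟨p, q⟩, r⟩ h
    simp only [coe_product, Set.mem_prod, mem_coe, mem_powersetCard] at h
    obtain ⟨⟨⟨hp, rfl⟩, hq, rfl⟩, hr, rfl⟩ := h
    simp only [coe_filter, mem_powerset, Set.mem_ofPred_eq]
    refine ⟨by gcongr, ?_, ?_, ?_⟩ <;> congr 1 <;> ext t <;>
      simp only [mem_inter, mem_union] <;> grind
  · intro C hC
    simp only [coe_filter, mem_powerset, Set.mem_ofPred_eq] at hC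
    ext t
    have := @hC.1 t
    simp only [mem_union, mem_inter] at this ⊢
    tauto
  · rintro ⟨⟨p, q⟩, r⟩ h
    simp only [coe_product, Set.mem_prod, mem_coe, mem_powersetCard] at h
    obtain ⟨⟨⟨hp, -⟩, hq, -⟩, hr, -⟩ := h
    simp only [Prod.mk.injEq]
    refine ⟨⟨?_, ?_⟩, ?_⟩ <;> ext t <;> simp only [mem_inter, mem_union] <;> grind

open Finset in
/-- `C` is a 3-set meeting `A` and `B` in at most one point each, and missing `A ∩ B`. -/
def IsThird {n : ℕ} (A B C : Finset (Fin n)) : Prop :=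
  #C = 3 ∧ #(A ∩ C) ≤ 1 ∧ #(B ∩ C) ≤ 1 ∧ A ∩ B ∩ C = ∅

open Finset in
theorem card_filter_isThird {n : ℕ} (A B : Finset (Fin n)) :
    #{C | IsThird A B C} = (#(A ∪ B)ᶜ).choose 3 + (#(A \ B) + #(B \ A)) * (#(A ∪ B)ᶜ).choose 2
      + #(A \ B) * #(B \ A) * #(A ∪ B)ᶜ := by
  have hXY : Disjoint (A \ B) (B \ A) := disjoint_sdiff_sdiff
  have hXZ : Disjoint (A \ B) (A ∪ B)ᶜ := by
    rw [Finset.disjoint_left]; intro t; simp; tauto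
  have hYZ : Disjoint (B \ A) (A ∪ B)ᶜ := by
    rw [Finset.disjoint_left]; intro t; simp; tauto
  have split (C : Finset (Fin n)) : (C ⊆ A \ B ∪ B \ A ∪ (A ∪ B)ᶜ ↔ A ∩ B ∩ C = ∅) := by
    simp only [subset_iff, Finset.ext_iff, mem_union, mem_sdiff, mem_compl, mem_inter,
      notMem_empty, iff_false]
    exact forall_congr' fun t => by tauto
  have hA (C : Finset (Fin n)) (h : A ∩ B ∩ C = ∅) : A ∩ C = C ∩ (A \ B) := by
    ext t
    have := Finset.ext_iff.1 h t
    simp only [mem_inter, mem_sdiff, notMem_empty, iff_false] at this ⊢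
    tauto
  have hB (C : Finset (Fin n)) (h : A ∩ B ∩ C = ∅) : B ∩ C = C ∩ (B \ A) := by
    ext t
    have := Finset.ext_iff.1 h t
    simp only [mem_inter, mem_sdiff, notMem_empty, iff_false] at this ⊢
    tauto
  have hC (C : Finset (Fin n)) (h : A ∩ B ∩ C = ∅) :
      #C = #(C ∩ (A \ B)) + #(C ∩ (B \ A)) + #(C ∩ (A ∪ B)ᶜ) := by
    rw [← card_union_of_disjoint (hXY.mono inter_subset_right inter_subset_right),
      ← inter_union_distrib_left, ← card_union_of_disjoint, ← inter_union_distrib_left,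
      inter_eq_left.2 ((split C).2 h)]
    exact (disjoint_union_left.2 ⟨hXZ, hYZ⟩).mono inter_subset_right inter_subset_right
  have maps : ∀ C ∈ ({C | IsThird A B C} : Finset (Finset (Fin n))),
      (#(C ∩ (A \ B)), #(C ∩ (B \ A))) ∈ range 2 ×ˢ range 2 := by
    intro C h
    obtain ⟨-, h1, h2, h3⟩ := (mem_filter.1 h).2
    rw [hA C h3] at h1
    rw [hB C h3] at h2
    simp only [mem_product, mem_range]
    omega
  have fiber : ∀ p ∈ range 2 ×ˢ range 2,
      #{C ∈ ({C | IsThird A B C} : Finset (Finset (Fin n))) |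
        (#(C ∩ (A \ B)), #(C ∩ (B \ A))) = p} =
      (#(A \ B)).choose p.1 * (#(B \ A)).choose p.2 *
        (#(A ∪ B)ᶜ).choose (3 - p.1 - p.2) := by
    rintro ⟨a, b⟩ hp
    simp only [mem_product, mem_range] at hp
    rw [← card_filter_card_inter hXY hXZ hYZ]
    congr 1
    ext C
    simp only [mem_filter, mem_univ, true_and, mem_powerset, split, Prod.mk.injEq]
    rw [IsThird]
    by_cases h : A ∩ B ∩ C = ∅
    · rw [hC C h, hA C h, hB C h]
      simp only [h, true_and, and_true]
      omega
    · tauto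
  rw [card_eq_sum_card_fiberwise maps, sum_congr rfl fiber, sum_product]
  simp [sum_range_succ]
  ring

open Finset in
theorem card_filter_card_inter_eq {n : ℕ} {A : Finset (Fin n)} (hA : #A = 3) {i : ℕ}
    (hi : i ≤ 3) :
    #{B : Finset (Fin n) | #B = 3 ∧ #(A ∩ B) = i} = Nat.choose 3 i * (n - 3).choose (3 - i) := by
  have h := card_filter_card_inter (X := A) (Y := ∅) (Z := Aᶜ) (by simp) disjoint_compl_right
    (by simp) i 0 (3 - i)
  rw [card_compl, hA, Fintype.card_fin] at h
  have hu : A ∪ ∅ ∪ Aᶜ = univ := by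
    ext t
    simp
  rw [hu] at h
  simp only [card_empty, Nat.choose_self, mul_one] at h
  rw [← h]
  congr 1
  ext B
  have : #B = #(B ∩ A) + #(B ∩ Aᶜ) := by
    rw [← card_union_of_disjoint (disjoint_compl_right.mono inter_subset_right inter_subset_right),
      ← inter_union_distrib_left]
    simp
  simp only [mem_filter, mem_univ, true_and, inter_comm A B, powerset_univ, inter_empty,
    card_empty, this]
  omega

open Finset in
/-- `p` is an ordered triple of 3-sets meeting pairwise in at most one point, with no common
point. -/
def IsTriangle {n : ℕ} (p : Finset (Fin n) × Finset (Fin n) × Finset (Fin n)) : Prop :=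
  #p.1 = 3 ∧ (#p.2.1 = 3 ∧ #(p.1 ∩ p.2.1) ≤ 1) ∧ IsThird p.1 p.2.1 p.2.2

open Finset in
theorem card_filter_isThird_of_card {n : ℕ} {A B : Finset (Fin n)} (hA : #A = 3) (hB : #B = 3)
    {i : ℕ} (hi : #(A ∩ B) = i) :
    #{C | IsThird A B C} = (n - (6 - i)).choose 3 + ((3 - i) + (3 - i)) * (n - (6 - i)).choose 2
      + (3 - i) * (3 - i) * (n - (6 - i)) := by
  have h1 : #(A ∪ B) = 6 - i := by rw [card_union, hA, hB, hi]
  have h2 : #(A \ B) = 3 - i := by rw [card_sdiff, hA, inter_comm, hi]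
  have h3 : #(B \ A) = 3 - i := by rw [card_sdiff, hB, hi]
  rw [card_filter_isThird, card_compl, h1, h2, h3, Fintype.card_fin]

open Finset in
theorem card_filter_isTriangle (n : ℕ) :
    #{p : Finset (Fin n) × Finset (Fin n) × Finset (Fin n) | IsTriangle p} =
      n.choose 3 * ((n - 3).choose 3 * ((n - 6).choose 3 + 6 * (n - 6).choose 2 + 9 * (n - 6)) +
        3 * (n - 3).choose 2 * ((n - 5).choose 3 + 4 * (n - 5).choose 2 + 4 * (n - 5))) := by
  have inner (A : Finset (Fin n)) (hA : #A = 3) :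
      ∑ B with #B = 3 ∧ #(A ∩ B) ≤ 1, #{C | IsThird A B C} =
      (n - 3).choose 3 * ((n - 6).choose 3 + 6 * (n - 6).choose 2 + 9 * (n - 6)) +
        3 * (n - 3).choose 2 * ((n - 5).choose 3 + 4 * (n - 5).choose 2 + 4 * (n - 5)) := by
    have maps : ∀ B ∈ ({B | #B = 3 ∧ #(A ∩ B) ≤ 1} : Finset (Finset (Fin n))),
        #(A ∩ B) ∈ range 2 := by
      intro B hB
      have := (mem_filter.1 hB).2.2
      rw [mem_range]
      omega
    have fiber : ∀ i ∈ range 2,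
        ∑ B ∈ {B ∈ ({B | #B = 3 ∧ #(A ∩ B) ≤ 1} : Finset (Finset (Fin n))) | #(A ∩ B) = i},
          #{C | IsThird A B C} = Nat.choose 3 i * (n - 3).choose (3 - i) *
        ((n - (6 - i)).choose 3 + ((3 - i) + (3 - i)) * (n - (6 - i)).choose 2
          + (3 - i) * (3 - i) * (n - (6 - i))) := by
      intro i hi
      rw [mem_range] at hi
      rw [← card_filter_card_inter_eq hA (by omega : i ≤ 3), ← smul_eq_mul, ← sum_const,
        filter_filter]
      refine sum_congr (filter_congr fun B _ => by omega) fun B hB => ?_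
      have hB := (mem_filter.1 hB).2
      exact card_filter_isThird_of_card hA hB.1 hB.2
    rw [← sum_fiberwise_of_maps_to maps, sum_congr rfl fiber]
    simp [sum_range_succ]
  have key : #{p : Finset (Fin n) × Finset (Fin n) × Finset (Fin n) | IsTriangle p} =
      ∑ A : Finset (Fin n) with #A = 3, ∑ B with #B = 3 ∧ #(A ∩ B) ≤ 1, #{C | IsThird A B C} := by
    rw [card_filter, ← univ_product_univ, sum_product, sum_filter]
    refine sum_congr rfl fun A _ => ?_
    rw [← univ_product_univ, sum_product, sum_filter]
    by_cases hA : #A = 3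
    · rw [if_pos hA]
      refine sum_congr rfl fun B _ => ?_
      by_cases hB : #B = 3 ∧ #(A ∩ B) ≤ 1
      · rw [if_pos hB, card_filter]
        exact sum_congr rfl fun C _ => by simp [IsTriangle, hA, hB]
      · rw [if_neg hB]
        exact sum_eq_zero fun C _ => if_neg fun h => hB h.2.1
    · rw [if_neg hA]
      exact sum_eq_zero fun B _ => sum_eq_zero fun C _ => if_neg fun h => hA h.1
  rw [key, sum_congr rfl fun A hA => inner A (mem_filter.1 hA).2, sum_const, smul_eq_mul]
  congr 1
  simp

theorem choose_identity (n : ℕ) :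
    n.choose 3 * ((n - 3).choose 3 * ((n - 6).choose 3 + 6 * (n - 6).choose 2 + 9 * (n - 6)) +
        3 * (n - 3).choose 2 * ((n - 5).choose 3 + 4 * (n - 5).choose 2 + 4 * (n - 5))) =
      6 * (280 * n.choose 9 + 840 * n.choose 8 + 630 * n.choose 7 + 120 * n.choose 6) := by
  rcases lt_or_ge n 9 with h | h
  · interval_cases n <;> rfl
  · obtain ⟨m, rfl⟩ := Nat.exists_eq_add_of_le' h
    have e (a k : ℕ) : (a.choose k : ℚ) = a.descFactorial k / k.factorial := by
      rw [Nat.descFactorial_eq_factorial_mul_choose]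
      field_simp
      push_cast
      ring
    simp only [Nat.reduceSubDiff]
    rw [← Nat.cast_inj (R := ℚ)]
    push_cast
    simp only [e]
    simp [Nat.descFactorial, Nat.factorial]
    ring

theorem Dd_pair {n : ℕ} {A B : Finset (Fin n)} (hA : A.card = 3) (hB : B.card = 3) (h : A ≠ B) :
    0 < Dd 3 {A, B} ↔ (A ∩ B).card ≤ 1 := by
  simp only [Dd, rho, codim, Finset.sum_pair h, Finset.inf_insert, Finset.inf_singleton, id,
    Finset.inf_eq_inter, hA, hB]
  omega

theorem Dd_triple {n : ℕ} {A B C : Finset (Fin n)} (hA : A.card = 3) (hB : B.card = 3)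
    (hC : C.card = 3) (hAB : A ≠ B) (hAC : A ≠ C) (hBC : B ≠ C) :
    0 < Dd 3 {A, B, C} ↔ A ∩ B ∩ C = ∅ := by
  rw [← Finset.card_eq_zero]
  simp only [Dd, rho, codim, Finset.inf_insert, Finset.inf_singleton, id,
    Finset.inf_eq_inter, Finset.inter_assoc]
  rw [Finset.sum_insert (by simp [hAB, hAC]), Finset.sum_pair hBC, hA, hB, hC]
  push_cast
  omega

theorem IsTriangle.ne {n : ℕ} {A B C : Finset (Fin n)} (h : IsTriangle (A, B, C)) :
    A ≠ B ∧ A ≠ C ∧ B ≠ C := by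
  obtain ⟨hA, ⟨hB, hAB⟩, hC, hAC, hBC, -⟩ := h
  dsimp only at *
  refine ⟨?_, ?_, ?_⟩ <;> rintro rfl <;> rw [Finset.inter_self] at * <;> omega

/-- A collection counted by the type `(1,1,1)`. -/
def IsTriangleColl {n : ℕ} (T : Coll n) : Prop :=
  T.card = 3 ∧ (∀ X ∈ T, X.card = 3) ∧ ∀ T' ⊆ T, 2 ≤ T'.card → 0 < Dd 3 T'

theorem eq_pair_or_triple_of_two_le_card {α : Type*} [DecidableEq α] {S : Finset α}
    {a b c : α} (hS : S ⊆ {a, b, c}) (hc : 2 ≤ S.card) :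
    S = {a, b} ∨ S = {a, c} ∨ S = {b, c} ∨ S = {a, b, c} := by
  obtain ⟨x, hx, y, hy, hxy⟩ := Finset.one_lt_card.1 hc
  have hx' := hS hx
  have hy' := hS hy
  simp only [Finset.ext_iff, Finset.subset_iff, Finset.mem_insert, Finset.mem_singleton] at *
  clear hc
  have hab : a ∈ S ∧ b ∈ S ∨ a ∈ S ∧ c ∈ S ∨ b ∈ S ∧ c ∈ S := by grind
  clear hx hy hxy hx' hy'
  by_cases ha : a ∈ S
  · by_cases hb : b ∈ S
    · by_cases hc : c ∈ S
      · exact Or.inr (Or.inr (Or.inr fun t => by grind))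
      · exact Or.inl fun t => by grind
    · exact Or.inr (Or.inl fun t => by grind)
  · exact Or.inr (Or.inr (Or.inl fun t => by grind))

theorem isTriangleColl_iff {n : ℕ} {A B C : Finset (Fin n)} (hAB : A ≠ B) (hAC : A ≠ C)
    (hBC : B ≠ C) : IsTriangleColl {A, B, C} ↔ IsTriangle (A, B, C) := by
  constructor
  · rintro ⟨-, h3, h⟩
    have hA := h3 A (by simp)
    have hB := h3 B (by simp)
    have hC := h3 C (by simp)
    refine ⟨hA, ⟨hB, ?_⟩, hC, ?_, ?_, ?_⟩
    · exact (Dd_pair hA hB hAB).1 (h _ (by grind) (by rw [Finset.card_pair hAB]))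
    · exact (Dd_pair hA hC hAC).1 (h _ (by grind) (by rw [Finset.card_pair hAC]))
    · exact (Dd_pair hB hC hBC).1 (h _ (by grind) (by rw [Finset.card_pair hBC]))
    · refine (Dd_triple hA hB hC hAB hAC hBC).1 (h _ subset_rfl ?_)
      rw [Finset.card_eq_three.2 ⟨A, B, C, hAB, hAC, hBC, rfl⟩]
      omega
  · rintro ⟨hA, ⟨hB, h1⟩, hC, h2, h3, h4⟩
    dsimp only at *
    refine ⟨Finset.card_eq_three.2 ⟨A, B, C, hAB, hAC, hBC, rfl⟩, by simp [hA, hB, hC], ?_⟩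
    intro T' hT' hc
    rcases eq_pair_or_triple_of_two_le_card hT' hc with rfl | rfl | rfl | rfl
    · exact (Dd_pair hA hB hAB).2 h1
    · exact (Dd_pair hA hC hAC).2 h2
    · exact (Dd_pair hB hC hBC).2 h3
    · exact (Dd_triple hA hB hC hAB hAC hBC).2 h4

open Finset in
theorem card_filter_eq_triple {α : Type*} [Fintype α] [DecidableEq α] {a b c : α}
    (hab : a ≠ b) (hac : a ≠ c) (hbc : b ≠ c) :
    #{p : α × α × α | ({p.1, p.2.1, p.2.2} : Finset α) = {a, b, c}} = 6 := by
  have : ({p : α × α × α | ({p.1, p.2.1, p.2.2} : Finset α) = {a, b, c}} : Finset _) =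
      {(a, b, c), (a, c, b), (b, a, c), (b, c, a), (c, a, b), (c, b, a)} := by
    ext ⟨x, y, z⟩
    simp only [mem_filter, mem_univ, true_and, mem_insert, mem_singleton, Prod.mk.injEq,
      Finset.ext_iff]
    constructor
    · intro h
      have := h x
      have := h y
      have := h z
      have := h a
      have := h b
      have := h c
      grind
    · rintro (⟨rfl, rfl, rfl⟩ | ⟨rfl, rfl, rfl⟩ | ⟨rfl, rfl, rfl⟩ | ⟨rfl, rfl, rfl⟩ |
        ⟨rfl, rfl, rfl⟩ | ⟨rfl, rfl, rfl⟩) t <;> tauto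
  rw [this]
  simp [card_insert_of_notMem, hab, hac, hbc, hab.symm, hac.symm, hbc.symm]

open Finset in
theorem card_isTriangle_eq_six_mul (n : ℕ) :
    #{p : Finset (Fin n) × Finset (Fin n) × Finset (Fin n) | IsTriangle p} =
      6 * #{T : Coll n | IsTriangleColl T} := by
  have maps : ∀ p ∈ ({p | IsTriangle p} : Finset (Finset (Fin n) × Finset (Fin n) × Finset (Fin n))),
      ({p.1, p.2.1, p.2.2} : Coll n) ∈ ({T : Coll n | IsTriangleColl T} : Finset (Coll n)) := by
    rintro ⟨A, B, C⟩ h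
    have h := (mem_filter.1 h).2
    obtain ⟨h1, h2, h3⟩ := h.ne
    exact mem_filter.2 ⟨mem_univ _, (isTriangleColl_iff h1 h2 h3).2 h⟩
  have fiber : ∀ T ∈ ({T : Coll n | IsTriangleColl T} : Finset (Coll n)),
      #{p ∈ ({p | IsTriangle p} : Finset (Finset (Fin n) × Finset (Fin n) × Finset (Fin n))) |
        ({p.1, p.2.1, p.2.2} : Coll n) = T} = 6 := by
    intro T hT
    have hT := (mem_filter.1 hT).2
    obtain ⟨a, b, c, hab, hac, hbc, rfl⟩ := Finset.card_eq_three.1 hT.1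
    rw [← card_filter_eq_triple hab hac hbc, filter_filter]
    congr 1
    refine filter_congr ?_
    rintro ⟨A, B, C⟩ -
    refine and_iff_right_of_imp fun h => ?_
    rw [← h] at hT
    have hc : #({A, B, C} : Coll n) = 3 := hT.1
    have hAB : A ≠ B := by
      rintro rfl
      have := card_le_two (a := A) (b := C)
      simp at hc
      omega
    have hAC : A ≠ C := by
      rintro rfl
      have := card_le_two (a := B) (b := A)
      simp at hc
      omega
    have hBC : B ≠ C := by
      rintro rfl
      have := card_le_two (a := A) (b := B)
      simp at hc
      omega
    exact (isTriangleColl_iff hAB hAC hBC).1 hT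
  rw [card_eq_sum_card_fiberwise maps, sum_congr rfl fiber, sum_const, smul_eq_mul, mul_comm]

/-- For `n ≥ 4`, the number of collections `T = {T₁,T₂,T₃}` of three
distinct 3-element subsets of `{1,…,n}` with `D₃(T') > 0` for every subcollection
`T'` with at least two members (i.e. pairwise and for the triple) — that is,
`λ_{n,3}((1,1,1))` — equals `280·C(n,9) + 840·C(n,8) + 630·C(n,7) + 120·C(n,6)`. -/
theorem count_type_111_dim_three (n : ℕ) (hn : 4 ≤ n) :
    (Finset.univ.filter (fun T : Coll n =>
        T.card = 3 ∧ (∀ X ∈ T, X.card = 3) ∧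
        ∀ T' ⊆ T, 2 ≤ T'.card → 0 < Dd 3 T')).card =
      280 * Nat.choose n 9 + 840 * Nat.choose n 8 + 630 * Nat.choose n 7 +
        120 * Nat.choose n 6 := by
  have h := card_isTriangle_eq_six_mul n
  rw [card_filter_isTriangle, choose_identity] at h
  rw [Nat.eq_of_mul_eq_mul_left (by norm_num) h]
  congr 1
  ext T
  rw [Finset.mem_filter, Finset.mem_filter, IsTriangleColl]
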